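/- Let G be a group, S a simple group, and (H i)_{i ∈ ι} a family of subgroups of G such that: for all distinct i, j, every element of H i commutes with every element of H j; for each i, H i ⊓ (⨆_{j ≠ i} H j) = ⊥; and ⨆ i, H i = ⊤. For each i let C i denote the image in G of the isotypical S-component (H i)_S of the group H i. Then C i ≤ G_S for every i, the family (C i) satisfies the same commutation and independence conditions, and ⨆ i, C i = G_S. (Isotypical components of an internal restricted direct sum decompose accordingly.) -/

import Mathlib

/-- The isotypical `S`-component of a group `G`: the subgroup generated by the
union of all subgroups of `G` that are normal in `G`, simple as groups, and
isomorphic to `S`. -/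
def IsoComponent (G : Type*) [Group G] (S : Type*) [Group S] : Subgroup G :=
  sSup {N : Subgroup G | N.Normal ∧ IsSimpleGroup N ∧ Nonempty (N ≃* S)}

/-- If `G` is the internal direct product of normal subgroups `A` and `B`, then there is a
projection of `G` onto `A` with `B` in its kernel. -/
theorem Subgroup.exists_projection_of_isCompl {G : Type*} [Group G] {A B : Subgroup G} [B.Normal]
    (h : IsCompl A B) :
    ∃ p : G →* A, (∀ x : A, p x = x) ∧ ∀ x ∈ B, p x = 1 := by
  let f : A →* G ⧸ B := (QuotientGroup.mk' B).comp A.subtype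
  have hinj : Function.Injective f := by
    rw [injective_iff_map_eq_one]
    intro a ha
    have hB : (a : G) ∈ B := (QuotientGroup.eq_one_iff (a : G)).mp ha
    exact Subtype.ext (Subgroup.disjoint_def.mp h.disjoint a.2 hB)
  have hsurj : Function.Surjective f := by
    intro q
    obtain ⟨g, rfl⟩ := QuotientGroup.mk'_surjective B q
    have hg : g ∈ A ⊔ B := h.sup_eq_top ▸ Subgroup.mem_top g
    obtain ⟨a, ha, b, hb, rfl⟩ := Subgroup.mem_sup_of_normal_right.mp hg
    refine ⟨⟨a, ha⟩, ?_⟩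
    have hb' : QuotientGroup.mk' B b = 1 := (QuotientGroup.eq_one_iff b).mpr hb
    rw [map_mul, hb', mul_one]
    rfl
  let e : A ≃* G ⧸ B := MulEquiv.ofBijective f ⟨hinj, hsurj⟩
  refine ⟨e.symm.toMonoidHom.comp (QuotientGroup.mk' B), fun x => e.symm_apply_apply x, ?_⟩
  intro x hx
  have hx' : QuotientGroup.mk' B x = 1 := (QuotientGroup.eq_one_iff x).mpr hx
  simp only [MonoidHom.comp_apply, hx', map_one]

/-- A normal subgroup of one member of a commuting generating family is normal in the group. -/
theorem Subgroup.normal_map_subtype_of_commute {G ι : Type*} [Group G] {H : ι → Subgroup G}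
    (hcomm : ∀ i j, i ≠ j → ∀ x ∈ H i, ∀ y ∈ H j, Commute x y) (hsup : (⨆ i, H i) = ⊤)
    (i : ι) (N : Subgroup (H i)) [hN : N.Normal] : (N.map (H i).subtype).Normal := by
  refine ⟨fun n hn g => ?_⟩
  have hg : g ∈ ⨆ j, H j := hsup ▸ Subgroup.mem_top g
  induction hg using Subgroup.iSup_induction' generalizing n with
  | hp j x hx =>
    obtain ⟨m, hm, rfl⟩ := hn
    obtain rfl | hij := eq_or_ne i j
    · exact ⟨⟨x, hx⟩ * m * ⟨x, hx⟩⁻¹, hN.conj_mem m hm _, rfl⟩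
    · have hc : Commute (m : G) x := hcomm i j hij m m.2 x hx
      refine ⟨m, hm, ?_⟩
      rw [Subgroup.subtype_apply, ← hc.eq, mul_inv_cancel_right]
  | h1 => simpa using hn
  | hmul x y _ _ hx hy =>
    have := hx _ (hy n hn)
    simpa only [mul_inv_rev, mul_assoc] using this

/-- The image of a simple subgroup is trivial or isomorphic to that subgroup. -/
theorem Subgroup.map_eq_bot_or_nonempty_mulEquiv {G G' : Type*} [Group G] [Group G']
    (f : G →* G') (N : Subgroup G) [IsSimpleGroup N] :
    N.map f = ⊥ ∨ Nonempty (N ≃* N.map f) := by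
  rcases (inferInstance : (f.subgroupMap N).ker.Normal).eq_bot_or_eq_top with h | h
  · exact Or.inr ⟨MulEquiv.ofBijective (f.subgroupMap N)
      ⟨(MonoidHom.ker_eq_bot_iff _).mp h, f.subgroupMap_surjective N⟩⟩
  · refine Or.inl ((Subgroup.eq_bot_iff_forall _).mpr ?_)
    rintro _ ⟨x, hx, rfl⟩
    have hk : (⟨x, hx⟩ : N) ∈ (f.subgroupMap N).ker := h ▸ Subgroup.mem_top _
    exact congrArg Subtype.val (MonoidHom.mem_ker.mp hk)

/-- An element of an internal direct sum lies in every subgroup containing its components. -/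
theorem Subgroup.mem_of_forall_projection_mem {G ι : Type*} [Group G] {H : ι → Subgroup G}
    (hnormal : ∀ i, (H i).Normal) (hsup : (⨆ i, H i) = ⊤) (p : ∀ i, G →* H i)
    (hself : ∀ i (x : H i), p i x = x)
    (hother : ∀ i, ∀ x ∈ ⨆ j, ⨆ (_ : j ≠ i), H j, p i x = 1)
    {M : Subgroup G} {g : G} (hM : ∀ i, (p i g : G) ∈ M) : g ∈ M := by
  classical
  have key : ∀ (s : Finset ι) (g : G), g ∈ ⨆ i ∈ s, H i →
      (∀ i ∈ s, (p i g : G) ∈ M) → g ∈ M := by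
    intro s
    induction s using Finset.induction_on with
    | empty =>
      intro g hg _
      have : g = 1 := by simpa using hg
      exact this ▸ M.one_mem
    | insert a s ha ih =>
      intro g hg hgM
      rw [Finset.iSup_insert] at hg
      have := hnormal a
      obtain ⟨h, hh, k, hk, rfl⟩ := Subgroup.mem_sup_of_normal_left.mp hg
      have hle : ⨆ i ∈ s, H i ≤ ⨆ j, ⨆ (_ : j ≠ a), H j :=
        iSup₂_le fun i hi => le_iSup₂_of_le i (ne_of_mem_of_not_mem hi ha) le_rfl
      have hha : h ∈ M := by
        have := hgM a (Finset.mem_insert_self a s)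
        rwa [map_mul, hother a k (hle hk), mul_one, hself a ⟨h, hh⟩] at this
      refine M.mul_mem hha (ih k hk fun i hi => ?_)
      have hai : a ≠ i := (ne_of_mem_of_not_mem hi ha).symm
      have hh1 : p i h = 1 :=
        hother i h ((le_iSup₂_of_le (f := fun j (_ : j ≠ i) => H j) a hai le_rfl) hh)
      have := hgM i (Finset.mem_insert_of_mem hi)
      rwa [map_mul, hh1, one_mul] at this
  have hg : g ∈ ⨆ i, H i := hsup ▸ Subgroup.mem_top g
  rw [iSup_eq_iSup_finset, Subgroup.mem_iSup_of_directed] at hg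
  · obtain ⟨s, hs⟩ := hg
    exact key s g hs fun i _ => hM i
  · exact Monotone.directed_le fun s t hst => biSup_mono fun i hi => Finset.mem_of_subset hst hi

theorem stmt_14 {G : Type*} [Group G] (S : Type*) [Group S] [IsSimpleGroup S]
    {ι : Type*} (H : ι → Subgroup G)
    (hCC : ∀ i j, i ≠ j → ∀ x ∈ H i, ∀ y ∈ H j, Commute x y)
    (hMI : ∀ i, H i ⊓ (⨆ j, ⨆ (_ : j ≠ i), H j) = ⊥)
    (hsup : (⨆ i, H i) = ⊤) :
    (∀ i, (IsoComponent (H i) S).map (H i).subtype ≤ IsoComponent G S) ∧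
      (∀ i j, i ≠ j → ∀ x ∈ (IsoComponent (H i) S).map (H i).subtype,
        ∀ y ∈ (IsoComponent (H j) S).map (H j).subtype, Commute x y) ∧
      (∀ i, (IsoComponent (H i) S).map (H i).subtype ⊓
        (⨆ j, ⨆ (_ : j ≠ i), (IsoComponent (H j) S).map (H j).subtype) = ⊥) ∧
      (⨆ i, (IsoComponent (H i) S).map (H i).subtype) = IsoComponent G S := by
  have hle : ∀ i, (IsoComponent (H i) S).map (H i).subtype ≤ H i :=
    fun i => Subgroup.map_subtype_le _
  have hcomp : ∀ i, (IsoComponent (H i) S).map (H i).subtype ≤ IsoComponent G S := by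
    intro i
    rw [Subgroup.map_le_iff_le_comap]
    refine sSup_le ?_
    rintro N ⟨hN, hsimple, ⟨e⟩⟩
    rw [← Subgroup.map_le_iff_le_comap]
    let e' : N ≃* N.map (H i).subtype := N.equivMapOfInjective _ (H i).subtype_injective
    exact le_sSup ⟨Subgroup.normal_map_subtype_of_commute hCC hsup i N,
      e'.isSimpleGroup_congr.mp hsimple, ⟨e'.symm.trans e⟩⟩
  refine ⟨hcomp, fun i j hij x hx y hy => hCC i j hij x (hle i hx) y (hle j hy),
    fun i => ?_, le_antisymm (iSup_le hcomp) (sSup_le ?_)⟩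
  · exact eq_bot_iff.mpr ((inf_le_inf (hle i) (iSup₂_mono fun j _ => hle j)).trans (hMI i).le)
  have hnormal : ∀ i, (H i).Normal := by
    intro i
    simpa [← MonoidHom.range_eq_map] using
      Subgroup.normal_map_subtype_of_commute hCC hsup i ⊤
  have hproj : ∀ i, ∃ p : G →* H i, (∀ x : H i, p x = x) ∧
      ∀ x ∈ ⨆ j, ⨆ (_ : j ≠ i), H j, p x = 1 := by
    intro i
    have : (⨆ j, ⨆ (_ : j ≠ i), H j).Normal :=
      Subgroup.iSup_normal _
    refine Subgroup.exists_projection_of_isCompl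
      ⟨disjoint_iff.mpr (hMI i), codisjoint_iff.mpr (eq_top_iff.mpr ?_)⟩
    rw [← hsup]
    refine iSup_le fun j => ?_
    obtain rfl | hji := eq_or_ne j i
    · exact le_sup_left
    · exact le_sup_of_le_right (le_iSup₂_of_le j hji le_rfl)
  choose p hself hother using hproj
  rintro N ⟨hN, hsimple, ⟨e⟩⟩ g hg
  refine Subgroup.mem_of_forall_projection_mem hnormal hsup p hself hother fun i => ?_
  have hmem : p i g ∈ N.map (p i) := Subgroup.mem_map_of_mem _ hg
  refine Subgroup.mem_iSup_of_mem i (Subgroup.mem_map_of_mem (H i).subtype ?_)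
  rcases N.map_eq_bot_or_nonempty_mulEquiv (p i) with h | ⟨⟨e'⟩⟩
  · rw [h, Subgroup.mem_bot] at hmem
    exact hmem ▸ Subgroup.one_mem _
  · have hsurj : Function.Surjective (p i) := fun x => ⟨x, hself i x⟩
    have hle_comp : N.map (p i) ≤ IsoComponent (H i) S :=
      le_sSup ⟨hN.map (p i) hsurj, e'.isSimpleGroup_congr.mp hsimple, ⟨e'.symm.trans e⟩⟩
    exact hle_comp hmem
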